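/- (Pseudo-geodesic Björling corollary.) Let I ⊆ ℝ be a nonempty open interval and γ : I → ℝ³ real-analytic with ⟨γ'(t), γ'(t)⟩ = −1 and ⟨γ''(t), γ''(t)⟩ > 0 for all t ∈ I (a unit-speed timelike curve with spacelike acceleration). Set W(t) = −γ''(t)/√⟨γ''(t), γ''(t)⟩ and define X : D(I) → ℝ³ by X(t,s) = ½(γ(t+s) + γ(t−s)) + ½ ∫_{t−s}^{t+s} W(τ) ×ₗ γ'(τ) dτ. Then: X(t,0) = γ(t) for all t ∈ I; X_tt = X_ss, ⟨X_t,X_s⟩ = 0 and ⟨X_t,X_t⟩ + ⟨X_s,X_s⟩ = 0 on all of D(I); there exists an open set U with I×{0} ⊆ U ⊆ D(I) on which ⟨X_t,X_t⟩ < 0; and for every t ∈ I the acceleration γ''(t) is Minkowski-orthogonal to both ∂X/∂t(t,0) and ∂X/∂s(t,0) — that is, γ is a geodesic of the timelike minimal surface X. -/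

import Mathlib

/-- Partial derivative in the first (t) coordinate. -/
noncomputable def pdt {E : Type*} [NormedAddCommGroup E] [NormedSpace ℝ E]
    (f : ℝ × ℝ → E) (p : ℝ × ℝ) : E := deriv (fun x => f (x, p.2)) p.1

/-- Partial derivative in the second (s) coordinate. -/
noncomputable def pds {E : Type*} [NormedAddCommGroup E] [NormedSpace ℝ E]
    (f : ℝ × ℝ → E) (p : ℝ × ℝ) : E := deriv (fun y => f (p.1, y)) p.2

/-- The Minkowski inner product on ℝ³ = ℝ × ℝ × ℝ: ⟨x,y⟩ = -x₁y₁ + x₂y₂ + x₃y₃. -/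
def mink (x y : ℝ × ℝ × ℝ) : ℝ := -(x.1 * y.1) + x.2.1 * y.2.1 + x.2.2 * y.2.2

/-- The Lorentzian cross product on ℝ³, characterized by ⟨u ×ₗ v, w⟩ = det[u,v,w]. -/
def lcross (u v : ℝ × ℝ × ℝ) : ℝ × ℝ × ℝ :=
  (-(u.2.1 * v.2.2 - u.2.2 * v.2.1), u.2.2 * v.1 - u.1 * v.2.2, u.1 * v.2.1 - u.2.1 * v.1)

/-- Diamond domain D(I) = {(t,s) : t+s ∈ I and t−s ∈ I}. -/
def diamond (I : Set ℝ) : Set (ℝ × ℝ) := {p | p.1 + p.2 ∈ I ∧ p.1 - p.2 ∈ I}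

/-- The first partial derivatives of a superposition of two travelling waves. -/
theorem pdt_pds_of_eq_add {E : Type*} [NormedAddCommGroup E] [NormedSpace ℝ E] {I : Set ℝ}
    (hI : IsOpen I) {X : ℝ × ℝ → E} {P Q P' Q' : ℝ → E}
    (hX : ∀ p ∈ diamond I, X p = P (p.1 + p.2) + Q (p.1 - p.2))
    (hP : ∀ u ∈ I, HasDerivAt P (P' u) u) (hQ : ∀ u ∈ I, HasDerivAt Q (Q' u) u) :
    ∀ p ∈ diamond I, pdt X p = P' (p.1 + p.2) + Q' (p.1 - p.2) ∧
      pds X p = P' (p.1 + p.2) + -Q' (p.1 - p.2) := by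
  rintro ⟨t, s⟩ ⟨h1, h2⟩
  simp only at h1 h2
  constructor
  · have hev : (fun x => X (x, s)) =ᶠ[nhds t] fun x => P (x + s) + Q (x - s) := by
      have ho : IsOpen {x : ℝ | x + s ∈ I ∧ x - s ∈ I} :=
        (hI.preimage (by fun_prop : Continuous fun x : ℝ => x + s)).inter
          (hI.preimage (by fun_prop : Continuous fun x : ℝ => x - s))
      filter_upwards [ho.mem_nhds ⟨h1, h2⟩] with x hx
      exact hX (x, s) hx
    exact (hev.deriv_eq).trans
      (((hP _ h1).comp_add_const t s).add ((hQ _ h2).comp_sub_const t s)).deriv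
  · have hev : (fun y => X (t, y)) =ᶠ[nhds s] fun y => P (t + y) + Q (t - y) := by
      have ho : IsOpen {y : ℝ | t + y ∈ I ∧ t - y ∈ I} :=
        (hI.preimage (by fun_prop : Continuous fun y : ℝ => t + y)).inter
          (hI.preimage (by fun_prop : Continuous fun y : ℝ => t - y))
      filter_upwards [ho.mem_nhds ⟨h1, h2⟩] with y hy
      exact hX (t, y) hy
    exact (hev.deriv_eq).trans
      (((hP _ h1).comp_const_add t s).add ((hQ _ h2).comp_const_sub t s)).deriv

theorem isOpen_diamond {I : Set ℝ} (hI : IsOpen I) : IsOpen (diamond I) :=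
  (hI.preimage (by fun_prop : Continuous fun p : ℝ × ℝ => p.1 + p.2)).inter
    (hI.preimage (by fun_prop : Continuous fun p : ℝ × ℝ => p.1 - p.2))

theorem mink_lcross_self (u v : ℝ × ℝ × ℝ) :
    mink (lcross u v) (lcross u v) = mink u v ^ 2 - mink u u * mink v v := by
  simp only [mink, lcross]; ring

theorem mink_lcross_right (u v : ℝ × ℝ × ℝ) : mink v (lcross u v) = 0 := by
  simp only [mink, lcross]; ring

theorem mink_lcross_left (u v : ℝ × ℝ × ℝ) : mink u (lcross u v) = 0 := by
  simp only [mink, lcross]; ring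

theorem mink_smul_left (c : ℝ) (u v : ℝ × ℝ × ℝ) : mink (c • u) v = c * mink u v := by
  simp only [mink, Prod.smul_fst, Prod.smul_snd, smul_eq_mul]; ring

theorem mink_smul_right (c : ℝ) (u v : ℝ × ℝ × ℝ) : mink u (c • v) = c * mink u v := by
  simp only [mink, Prod.smul_fst, Prod.smul_snd, smul_eq_mul]; ring

theorem lcross_smul_left (c : ℝ) (u v : ℝ × ℝ × ℝ) : lcross (c • u) v = c • lcross u v := by
  simp only [lcross, Prod.smul_fst, Prod.smul_snd, smul_eq_mul, Prod.smul_mk]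
  ext <;> simp <;> ring

theorem DifferentiableAt.mink {f g : ℝ → ℝ × ℝ × ℝ} {t : ℝ} (hf : DifferentiableAt ℝ f t)
    (hg : DifferentiableAt ℝ g t) : DifferentiableAt ℝ (fun τ => mink (f τ) (g τ)) t := by
  unfold _root_.mink; fun_prop

theorem DifferentiableAt.lcross {f g : ℝ → ℝ × ℝ × ℝ} {t : ℝ} (hf : DifferentiableAt ℝ f t)
    (hg : DifferentiableAt ℝ g t) : DifferentiableAt ℝ (fun τ => lcross (f τ) (g τ)) t := by
  unfold _root_.lcross; fun_prop

/-- The velocity of a curve of constant Minkowski speed is orthogonal to its acceleration. -/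
theorem mink_deriv_eq_zero {I : Set ℝ} (hI : IsOpen I) {f : ℝ → ℝ × ℝ × ℝ} {c : ℝ}
    (hf : ∀ t ∈ I, DifferentiableAt ℝ f t) (hc : ∀ t ∈ I, mink (f t) (f t) = c) :
    ∀ t ∈ I, mink (deriv f t) (f t) = 0 := by
  intro t ht
  have h := (hf t ht).hasDerivAt
  have h1 : HasDerivAt (fun τ => (f τ).1) (deriv f t).1 t := by
    simpa using (h.hasFDerivAt.fst).hasDerivAt
  have h2 : HasDerivAt (fun τ => (f τ).2.1) (deriv f t).2.1 t := by
    simpa using (h.hasFDerivAt.snd.fst).hasDerivAt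
  have h3 : HasDerivAt (fun τ => (f τ).2.2) (deriv f t).2.2 t := by
    simpa using (h.hasFDerivAt.snd.snd).hasDerivAt
  have hd : HasDerivAt (fun τ => mink (f τ) (f τ)) (2 * mink (deriv f t) (f t)) t := by
    refine ((((h1.mul h1).neg).add (h2.mul h2)).add (h3.mul h3)).congr_deriv ?_
    simp only [mink]; ring
  have he : (fun τ => mink (f τ) (f τ)) =ᶠ[nhds t] fun _ => c := by
    filter_upwards [hI.mem_nhds ht] with τ hτ using hc τ hτ
  have h0 := hd.deriv.symm.trans (he.deriv_eq.trans (deriv_const t c))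
  linarith

/-- Pseudo-geodesic Björling corollary: a unit-speed real-analytic timelike curve with
spacelike acceleration is a geodesic of the timelike minimal surface obtained from the
Björling formula with W = −γ''/|γ''|. -/
theorem stmt13 (I : Set ℝ) (hI : IsOpen I) (hne : I.Nonempty) (hord : I.OrdConnected)
    (γ : ℝ → ℝ × ℝ × ℝ) (hγ : AnalyticOnNhd ℝ γ I)
    (hunit : ∀ t ∈ I, mink (deriv γ t) (deriv γ t) = -1)
    (hacc : ∀ t ∈ I, 0 < mink (deriv (deriv γ) t) (deriv (deriv γ) t))
    (W : ℝ → ℝ × ℝ × ℝ)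
    (hWdef : ∀ t : ℝ, W t =
      -((Real.sqrt (mink (deriv (deriv γ) t) (deriv (deriv γ) t)))⁻¹ • deriv (deriv γ) t))
    (X : ℝ × ℝ → ℝ × ℝ × ℝ)
    (hXdef : ∀ p : ℝ × ℝ, X p = (1 / 2 : ℝ) • (γ (p.1 + p.2) + γ (p.1 - p.2)) +
        (1 / 2 : ℝ) • ∫ τ in (p.1 - p.2)..(p.1 + p.2), lcross (W τ) (deriv γ τ)) :
    (∀ t ∈ I, X (t, 0) = γ t) ∧
    (∀ p ∈ diamond I, pdt (pdt X) p = pds (pds X) p ∧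
        mink (pdt X p) (pds X p) = 0 ∧
        mink (pdt X p) (pdt X p) + mink (pds X p) (pds X p) = 0) ∧
    (∃ U : Set (ℝ × ℝ), IsOpen U ∧ (∀ t ∈ I, (t, (0 : ℝ)) ∈ U) ∧ U ⊆ diamond I ∧
        ∀ p ∈ U, mink (pdt X p) (pdt X p) < 0) ∧
    (∀ t ∈ I, mink (deriv (deriv γ) t) (pdt X (t, 0)) = 0 ∧
        mink (deriv (deriv γ) t) (pds X (t, 0)) = 0) := by
  set V : ℝ → ℝ × ℝ × ℝ := fun τ => lcross (W τ) (deriv γ τ) with hV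
  have hd0 : ∀ t ∈ I, HasDerivAt γ (deriv γ t) t := fun t ht =>
    (hγ t ht).differentiableAt.hasDerivAt
  have hd1 : ∀ t ∈ I, DifferentiableAt ℝ (deriv γ) t := fun t ht =>
    (hγ t ht).deriv.differentiableAt
  have hd2 : ∀ t ∈ I, DifferentiableAt ℝ (deriv (deriv γ)) t := fun t ht =>
    (hγ t ht).deriv.deriv.differentiableAt
  have hdV : ∀ t ∈ I, DifferentiableAt ℝ V t := by
    intro t ht
    refine DifferentiableAt.lcross ?_ (hd1 t ht)
    rw [funext hWdef]
    have hm := (hd2 t ht).mink (hd2 t ht)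
    exact (((hm.sqrt (hacc t ht).ne').inv (Real.sqrt_pos.2 (hacc t ht)).ne').smul (hd2 t ht)).neg
  have hVc : ContinuousOn V I := fun t ht => (hdV t ht).continuousAt.continuousWithinAt
  have horth := mink_deriv_eq_zero hI hd1 hunit
  have hWs : ∀ t, W t =
      (-(Real.sqrt (mink (deriv (deriv γ) t) (deriv (deriv γ) t)))⁻¹) • deriv (deriv γ) t := by
    intro t; rw [hWdef, neg_smul]
  have hVV : ∀ t ∈ I, mink (V t) (V t) = 1 := by
    intro t ht
    have hp := hacc t ht
    have hsq := Real.sq_sqrt hp.le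
    have hne := (Real.sqrt_pos.2 hp).ne'
    rw [hV]
    simp only
    rw [mink_lcross_self, hunit t ht, hWs, mink_smul_left, mink_smul_left, mink_smul_right,
      horth t ht]
    field_simp
    linarith
  have hγV : ∀ t, mink (deriv γ t) (V t) = 0 := fun t => mink_lcross_right _ _
  have haV : ∀ t, mink (deriv (deriv γ) t) (V t) = 0 := by
    intro t
    rw [hV]
    simp only
    rw [hWs, lcross_smul_left, mink_smul_right, mink_lcross_left, mul_zero]
  obtain ⟨c, hc⟩ := hne
  have hint : ∀ a ∈ I, ∀ b ∈ I, IntervalIntegrable V MeasureTheory.volume a b := fun a ha b hb =>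
    (hVc.mono (hord.uIcc_subset ha hb)).intervalIntegrable
  have hG : ∀ u ∈ I, HasDerivAt (fun u => ∫ τ in c..u, V τ) (V u) u := fun u hu =>
    intervalIntegral.integral_hasDerivAt_right (hint c hc u hu)
      (hVc.stronglyMeasurableAtFilter hI u hu) (hdV u hu).continuousAt
  have hX : ∀ p ∈ diamond I, X p =
      (fun u => (1 / 2 : ℝ) • (γ u + ∫ τ in c..u, V τ)) (p.1 + p.2) +
      (fun u => (1 / 2 : ℝ) • (γ u - ∫ τ in c..u, V τ)) (p.1 - p.2) := by
    intro p hp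
    rw [hXdef, ← intervalIntegral.integral_interval_sub_left (hint c hc _ hp.1)
      (hint c hc _ hp.2)]
    module
  have hX1 := pdt_pds_of_eq_add hI hX
    (fun u hu => ((hd0 u hu).add (hG u hu)).const_smul (1 / 2 : ℝ))
    (fun u hu => ((hd0 u hu).sub (hG u hu)).const_smul (1 / 2 : ℝ))
  have hP2 : ∀ u ∈ I, HasDerivAt (fun u => (1 / 2 : ℝ) • (deriv γ u + V u))
      ((1 / 2 : ℝ) • (deriv (deriv γ) u + deriv V u)) u := fun u hu =>
    ((hd1 u hu).hasDerivAt.add (hdV u hu).hasDerivAt).const_smul (1 / 2 : ℝ)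
  have hQ2 : ∀ u ∈ I, HasDerivAt (fun u => (1 / 2 : ℝ) • (deriv γ u - V u))
      ((1 / 2 : ℝ) • (deriv (deriv γ) u - deriv V u)) u := fun u hu =>
    ((hd1 u hu).hasDerivAt.sub (hdV u hu).hasDerivAt).const_smul (1 / 2 : ℝ)
  have hmem : ∀ t ∈ I, (t, (0 : ℝ)) ∈ diamond I := fun t ht => by simpa [diamond] using ht
  have hXt0 : ∀ t ∈ I, pdt X (t, 0) = deriv γ t := by
    intro t ht
    rw [(hX1 _ (hmem t ht)).1]
    simp only [add_zero, sub_zero]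
    module
  have hXs0 : ∀ t ∈ I, pds X (t, 0) = V t := by
    intro t ht
    rw [(hX1 _ (hmem t ht)).2]
    simp only [add_zero, sub_zero]
    module
  refine ⟨fun t _ => ?_, fun p hp => ⟨?_, ?_⟩, ?_, fun t ht => ⟨?_, ?_⟩⟩
  · rw [hXdef]
    simp only [add_zero, sub_zero, intervalIntegral.integral_same]
    module
  · rw [(pdt_pds_of_eq_add hI (fun p hp => (hX1 p hp).1) hP2 hQ2 p hp).1,
      (pdt_pds_of_eq_add hI (fun p hp => (hX1 p hp).2) hP2 (fun u hu => (hQ2 u hu).neg) p hp).2,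
      neg_neg]
  · rw [(hX1 p hp).1, (hX1 p hp).2]
    have a1 := hunit _ hp.1
    have a2 := hVV _ hp.1
    have a3 := hγV (p.1 + p.2)
    have b1 := hunit _ hp.2
    have b2 := hVV _ hp.2
    have b3 := hγV (p.1 - p.2)
    generalize deriv γ (p.1 + p.2) = A at *
    generalize V (p.1 + p.2) = B at *
    generalize deriv γ (p.1 - p.2) = C at *
    generalize V (p.1 - p.2) = D at *
    simp only [mink, Prod.smul_fst, Prod.smul_snd, Prod.fst_add, Prod.snd_add, Prod.fst_sub,
      Prod.snd_sub, Prod.fst_neg, Prod.snd_neg, smul_eq_mul] at *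
    constructor
    · linear_combination (a1 + a2 + 2 * a3 - b1 - b2 + 2 * b3) / 4
    · linear_combination (a1 + a2 + 2 * a3 + b1 + b2 - 2 * b3) / 2
  · have hcont : ContinuousOn (fun p => mink (pdt X p) (pdt X p)) (diamond I) := by
      have hXt : ContinuousOn (pdt X) (diamond I) := by
        refine ContinuousOn.congr ?_ fun p hp => (hX1 p hp).1
        refine ContinuousOn.add ?_ ?_
        · exact ContinuousOn.comp (g := fun u => (1 / 2 : ℝ) • (deriv γ u + V u)) (t := I)
            (fun u hu => (hP2 u hu).continuousAt.continuousWithinAt) (by fun_prop)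
            fun p hp => hp.1
        · exact ContinuousOn.comp (g := fun u => (1 / 2 : ℝ) • (deriv γ u - V u)) (t := I)
            (fun u hu => (hQ2 u hu).continuousAt.continuousWithinAt) (by fun_prop)
            fun p hp => hp.2
      unfold mink
      fun_prop
    refine ⟨_, hcont.isOpen_inter_preimage (isOpen_diamond hI) isOpen_Iio,
      fun t ht => ⟨hmem t ht, ?_⟩, Set.inter_subset_left, fun p hp => hp.2⟩
    simp only [Set.mem_preimage, Set.mem_Iio]
    rw [hXt0 t ht, hunit t ht]
    norm_num
  · rw [hXt0 t ht, horth t ht]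
  · rw [hXs0 t ht, haV t]
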